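/- (Bound on on-average parameter stability) Fix t > 0 and suppose η ≤ 1/(2ρ) and 2ηε < 1, where ε = 2 C_x² √C_0 B_{φ''} (4 B_{φ'} C_x √(ηt) + √2)/√m. Then (1/n) Σ_{i=1}^n E[‖W_{t+1} − W_{t+1}^{(i)}‖_F²] ≤ 8e (η² t/n²) (1/(1 − 2ηε))^t · (1/n) Σ_{i=1}^n Σ_{j=0}^{t} E[‖∇ℓ(W_j, z_i)‖₂²], where expectations are over the sample S and the independent copies z̃_i. -/

import Mathlib

open MeasureTheory Finset
open scoped BigOperators

noncomputable section

/-- The parameter space of a width-`m` shallow network on `ℝ^d`, with the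
Euclidean (= Frobenius, after vectorisation) norm. -/
abbrev Param (d m : ℕ) : Type := EuclideanSpace ℝ (Fin m × Fin d)

/-- Inputs live in `ℝ^d` with the Euclidean norm. -/
abbrev Input (d : ℕ) : Type := EuclideanSpace ℝ (Fin d)

/-- Shallow network `f_W(x) = ∑ₖ uₖ φ(⟨Wₖ, x⟩)`. -/
def nnet {d m : ℕ} (φ : ℝ → ℝ) (u : Fin m → ℝ) (W : Param d m) (x : Input d) : ℝ :=
  ∑ k : Fin m, u k * φ (∑ j : Fin d, W (k, j) * x j)

/-- Squared loss `ℓ(W, (x, y)) = (f_W(x) − y)² / 2`. -/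
def sqLoss {d m : ℕ} (φ : ℝ → ℝ) (u : Fin m → ℝ) (W : Param d m) (z : Input d × ℝ) : ℝ :=
  (nnet φ u W z.1 - z.2) ^ 2 / 2

/-- Empirical risk `L_S(W) = (1/n) ∑ᵢ ℓ(W, zᵢ)`. -/
def empRisk {d m n : ℕ} (φ : ℝ → ℝ) (u : Fin m → ℝ) (S : Fin n → Input d × ℝ)
    (W : Param d m) : ℝ :=
  (∑ i : Fin n, sqLoss φ u W (S i)) / n

/-- Gradient-descent iterates `W_{t+1} = W_t − η ∇L(W_t)` started at `W0`. -/
def gdIter {d m : ℕ} (η : ℝ) (L : Param d m → ℝ) (W0 : Param d m) : ℕ → Param d m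
  | 0 => W0
  | t + 1 => gdIter η L W0 t - η • gradient L (gdIter η L W0 t)

end

section Abstract
variable {E : Type*} [NormedAddCommGroup E] [InnerProductSpace ℝ E] [CompleteSpace E]

lemma aux_descent (L : E → ℝ) (g : E → E) (ρ η : ℝ)
    (hg : ∀ W, HasGradientAt L (g W) W)
    (hlip : ∀ W V, ‖g W - g V‖ ≤ ρ * ‖W - V‖) (hη0 : 0 < η) (hη : η * ρ ≤ 1) (W : E) :
    L (W - η • g W) ≤ L W - η / 2 * ‖g W‖ ^ 2 := by
  set v := g W with hv
  have hd : ∀ a : ℝ, HasDerivAt (fun a : ℝ => L (W - (a * η) • v) + a * η * ‖v‖^2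
      - a ^ 2 * (η / 2 * ‖v‖^2)) (inner ℝ (g (W - (a * η) • v)) (-(η • v)) + η * ‖v‖^2 - 2 * a * (η/2 * ‖v‖^2)) a := by
    intro a
    have h1 : HasDerivAt (fun a : ℝ => W - (a * η) • v) (-(η • v)) a := by
      have := (((hasDerivAt_id a).mul_const η).smul_const v).const_sub W
      simpa using this
    have h2 := (hg (W - (a * η) • v)).hasFDerivAt.comp_hasDerivAt a h1
    have h3 := (((hasDerivAt_id a).mul_const η).mul_const (‖v‖^2))
    have h4 := ((hasDerivAt_id a).pow 2).mul_const (η / 2 * ‖v‖^2)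
    refine ((h2.add h3).sub h4).congr_deriv ?_
    simp
  have hanti : AntitoneOn (fun a : ℝ => L (W - (a * η) • v) + a * η * ‖v‖^2
      - a ^ 2 * (η / 2 * ‖v‖^2)) (Set.Icc 0 1) := by
    apply antitoneOn_of_deriv_nonpos (convex_Icc 0 1)
    · exact fun a _ => (hd a).continuousAt.continuousWithinAt
    · exact fun a _ => (hd a).differentiableAt.differentiableWithinAt
    · intro a ha
      rw [interior_Icc] at ha
      rw [(hd a).deriv]
      have h0 := ha.1
      have e1 : inner ℝ (g (W - (a * η) • v)) (-(η • v))
          = η * inner ℝ (v - g (W - (a * η) • v)) v - η * ‖v‖^2 := by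
        rw [inner_neg_right, inner_smul_right, inner_sub_left, real_inner_self_eq_norm_sq]; ring
      have e2 : inner ℝ (v - g (W - (a * η) • v)) v ≤ ‖v - g (W - (a * η) • v)‖ * ‖v‖ :=
        real_inner_le_norm _ _
      have e3 : ‖v - g (W - (a * η) • v)‖ ≤ ρ * (a * η * ‖v‖) := by
        have := hlip W (W - (a * η) • v)
        rw [← hv] at this
        rw [sub_sub_cancel, norm_smul, Real.norm_of_nonneg (by positivity)] at this
        exact this
      have e4 : inner ℝ (v - g (W - (a * η) • v)) v ≤ a * ‖v‖^2 := by
        calc _ ≤ _ := e2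
          _ ≤ ρ * (a * η * ‖v‖) * ‖v‖ := by gcongr
          _ = (η * ρ) * (a * ‖v‖^2) := by ring
          _ ≤ 1 * (a * ‖v‖^2) := by gcongr
          _ = _ := by ring
      rw [e1]
      nlinarith
  have := hanti (Set.left_mem_Icc.2 zero_le_one) (Set.right_mem_Icc.2 zero_le_one) zero_le_one
  simp at this
  linarith

lemma aux_gd (L : E → ℝ) (g : E → E) (ρ η : ℝ)
    (hg : ∀ W, HasGradientAt L (g W) W) 
    (hlip : ∀ W V, ‖g W - g V‖ ≤ ρ * ‖W - V‖) (hη0 : 0 < η) (hη : η * ρ ≤ 1) (w : ℕ → E)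
    (hw : ∀ s, w (s+1) = w s - η • g (w s)) (s : ℕ) :
    L (w s) ≤ L (w 0) ∧ ‖w s - w 0‖ ^ 2 ≤ 2 * η * s * (L (w 0) - L (w s)) := by
  induction s with
  | zero => simp
  | succ s ih =>
    obtain ⟨i1, i2⟩ := ih
    have hd := aux_descent L g ρ η hg hlip hη0 hη (w s)
    rw [← hw] at hd
    have hp : 0 ≤ η / 2 * ‖g (w s)‖ ^ 2 := by positivity
    refine ⟨by linarith, ?_⟩
    have h1 : ‖w (s+1) - w 0‖ ≤ ‖w s - w 0‖ + η * ‖g (w s)‖ := by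
      rw [hw, sub_right_comm]
      refine (norm_sub_le _ _).trans ?_
      rw [norm_smul, Real.norm_of_nonneg hη0.le]
    set a := ‖w s - w 0‖
    set b := η * ‖g (w s)‖ with hb
    have hb2 : b ^ 2 ≤ 2 * η * (L (w s) - L (w (s+1))) := by
      rw [hb]; nlinarith
    set A := 2 * η * (L (w 0) - L (w s)) with hA
    set B := 2 * η * (L (w s) - L (w (s+1))) with hB
    have hA0 : 0 ≤ A := by rw [hA]; apply mul_nonneg (by positivity); linarith
    have ha : a ^ 2 ≤ s * A := by rw [hA]; linarith
    have hgoal : (a + b)^2 ≤ (s + 1) * (A + B) := by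
      rcases Nat.eq_zero_or_pos s with h0 | h0
      · subst h0
        simp at ha
        have : a = 0 := by nlinarith [sq_nonneg a, pow_eq_zero_iff (two_ne_zero) (a := a) |>.1 (le_antisymm (by simp [ha]) (sq_nonneg a))]
        rw [this]; simp; linarith
      · have hs : (0:ℝ) < s := by exact_mod_cast h0
        have h2 : 2 * a * b * s ≤ (A + s * B) * s := by nlinarith [sq_nonneg (a - s * b), mul_le_mul_of_nonneg_left hb2 (sq_nonneg (s:ℝ))]
        have h3 := le_of_mul_le_mul_right h2 hs
        nlinarith
    calc ‖w (s+1) - w 0‖ ^ 2 ≤ (a + b)^2 := by gcongr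
      _ ≤ _ := hgoal
      _ = _ := by rw [hA, hB]; push_cast; ring

lemma aux_psd {ι : Type*} (s : Finset ι) (N : ℝ) (hN : 0 < N) (hs : (s.card : ℝ) ≤ N)
    (b η : ℝ) (hη0 : 0 < η) (hb : η * b ^ 2 ≤ 2) (G : ι → E) (hG : ∀ j ∈ s, ‖G j‖ ≤ b) (D : E) :
    ‖D - (η / N) • ∑ j ∈ s, (inner ℝ (G j) D : ℝ) • G j‖ ≤ ‖D‖ := by
  set P := ∑ j ∈ s, (inner ℝ (G j) D : ℝ) • G j with hP
  set Q := ∑ j ∈ s, (inner ℝ (G j) D : ℝ)^2 with hQ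
  have hQ0 : 0 ≤ Q := Finset.sum_nonneg fun _ _ => sq_nonneg _
  have h1 : inner ℝ D P = Q := by
    rw [hP, hQ, _root_.inner_sum]
    refine Finset.sum_congr rfl fun j _ => ?_
    rw [inner_smul_right, real_inner_comm]; ring
  have h2 : ‖P‖ ^ 2 ≤ N * (b^2 * Q) := by
    calc ‖P‖^2 ≤ (∑ j ∈ s, |(inner ℝ (G j) D : ℝ)| * b)^2 := by
          gcongr
          refine (norm_sum_le _ _).trans (Finset.sum_le_sum fun j hj => ?_)
          rw [norm_smul, Real.norm_eq_abs]
          gcongr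
          exact hG j hj
      _ ≤ s.card * ∑ j ∈ s, (|(inner ℝ (G j) D : ℝ)| * b)^2 := sq_sum_le_card_mul_sum_sq
      _ = s.card * (b^2 * Q) := by
          have : ∑ j ∈ s, (|(inner ℝ (G j) D : ℝ)| * b)^2 = b^2 * Q := by
            rw [hQ, Finset.mul_sum]
            refine Finset.sum_congr rfl fun j _ => ?_
            rw [mul_pow, sq_abs]; ring
          rw [this]
      _ ≤ _ := by gcongr
  have h3 : ‖D - (η / N) • P‖^2 ≤ ‖D‖^2 := by
    rw [norm_sub_sq_real, inner_smul_right, h1, norm_smul, mul_pow, Real.norm_eq_abs, sq_abs]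
    have : (η/N)^2 * ‖P‖^2 ≤ 2 * (η / N * Q) := by
      calc (η/N)^2 * ‖P‖^2 ≤ (η/N)^2 * (N * (b^2 * Q)) := by gcongr
        _ = (η * b^2) * (η / N * Q) := by field_simp
        _ ≤ _ := by gcongr
    linarith
  exact abs_le_of_sq_le_sq' h3 (norm_nonneg _) |>.2

lemma aux_contract {ι : Type*} (s : Finset ι) (N : ℝ) (hN : 0 < N) (hs : (s.card : ℝ) ≤ N)
    (b κ η M : ℝ) (hb0 : 0 ≤ b) (hη0 : 0 < η) (hb : η * b ^ 2 ≤ 2) (f : ι → E → ℝ) (y : ι → ℝ) (G : ι → E → E)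
    (hf : ∀ j ∈ s, ∀ W, HasGradientAt (f j) (G j W) W)
    (hd : ∀ j ∈ s, Differentiable ℝ (G j))
    (hG : ∀ j ∈ s, ∀ W, ‖G j W‖ ≤ b)
    (hlip : ∀ j ∈ s, ∀ W V, ‖G j W - G j V‖ ≤ κ * ‖W - V‖) (hκ : 0 ≤ κ)
    (hfl : ∀ j ∈ s, ∀ W V, |f j W - f j V| ≤ b * ‖W - V‖)
    (W V : E) (hM : (∑ j ∈ s, |f j W - y j|) / N ≤ M) :
    ‖(W - (η / N) • ∑ j ∈ s, (f j W - y j) • G j W) - (V - (η / N) • ∑ j ∈ s, (f j V - y j) • G j V)‖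
      ≤ (1 + η * (κ * (M + b * ‖W - V‖))) * ‖W - V‖ := by
  set D := V - W with hD
  have hDn : ‖W - V‖ = ‖D‖ := norm_sub_rev _ _
  rw [hDn]
  let c : ℝ → E := fun a => W + a • D
  have hc : ∀ a, HasDerivAt c D a := by
    intro a
    have := ((hasDerivAt_id a).smul_const D).const_add W
    rw [one_smul] at this
    exact this
  let F : ℝ → E := fun a => c a - (η / N) • ∑ j ∈ s, (f j (c a) - y j) • G j (c a)
  have hF : ∀ a, HasDerivAt F (D - (η / N) • ∑ j ∈ s,
      ((f j (c a) - y j) • (fderiv ℝ (G j) (c a) D) + (inner ℝ (G j (c a)) D : ℝ) • G j (c a))) a := by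
    intro a
    refine (hc a).sub (HasDerivAt.const_smul _ (HasDerivAt.fun_sum fun j hj => ?_))
    have h1 := (hf j hj (c a)).hasFDerivAt.comp_hasDerivAt a (hc a)
    have h2 := ((hd j hj) (c a)).hasFDerivAt.comp_hasDerivAt a (hc a)
    have h3 := (h1.sub_const (y j)).smul h2
    exact h3
  have hbd : ∀ a ∈ Set.Ico (0:ℝ) 1, ‖D - (η / N) • ∑ j ∈ s,
      ((f j (c a) - y j) • (fderiv ℝ (G j) (c a) D) + (inner ℝ (G j (c a)) D : ℝ) • G j (c a))‖
      ≤ (1 + η * (κ * (M + b * ‖D‖))) * ‖D‖ := by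
    intro a ha
    rw [Finset.sum_add_distrib, smul_add, ← sub_sub, sub_right_comm]
    have h1 := aux_psd s N hN hs b η hη0 hb (fun j => G j (c a)) (fun j hj => hG j hj _) D
    have h2 : ‖∑ j ∈ s, (f j (c a) - y j) • (fderiv ℝ (G j) (c a) D)‖ ≤ N * ((κ * (M + b * ‖D‖)) * ‖D‖) := by
      calc _ ≤ ∑ j ∈ s, (|f j W - y j| + b * ‖D‖) * (κ * ‖D‖) := by
            refine (norm_sum_le _ _).trans (Finset.sum_le_sum fun j hj => ?_)
            rw [norm_smul, Real.norm_eq_abs]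
            have e1 : |f j (c a) - y j| ≤ |f j W - y j| + b * ‖D‖ := by
              have q1 := hfl j hj (c a) W
              have q2 : ‖c a - W‖ ≤ ‖D‖ := by
                simp only [c, add_sub_cancel_left, norm_smul, Real.norm_eq_abs, abs_of_nonneg ha.1]
                nlinarith [norm_nonneg D, ha.2]
              have q3 : b * ‖c a - W‖ ≤ b * ‖D‖ := by gcongr
              have q4 : |f j (c a) - y j| ≤ |f j (c a) - f j W| + |f j W - y j| := abs_sub_le _ _ _
              linarith
            have e2 : ‖fderiv ℝ (G j) (c a)‖ ≤ κ := by
              have : LipschitzWith (Real.toNNReal κ) (G j) := by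
                refine LipschitzWith.of_dist_le_mul fun x y => ?_
                rw [dist_eq_norm, dist_eq_norm, Real.coe_toNNReal _ hκ]
                exact hlip j hj x y
              have := norm_fderiv_le_of_lipschitz ℝ this (x₀ := c a)
              rwa [Real.coe_toNNReal _ hκ] at this
            have e3 : ‖fderiv ℝ (G j) (c a) D‖ ≤ κ * ‖D‖ :=
              ((fderiv ℝ (G j) (c a)).le_opNorm D).trans (by gcongr)
            gcongr
        _ = ((∑ j ∈ s, |f j W - y j|) + s.card * (b * ‖D‖)) * (κ * ‖D‖) := by
            rw [← Finset.sum_mul, Finset.sum_add_distrib]; simp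
        _ ≤ (N * M + N * (b * ‖D‖)) * (κ * ‖D‖) := by
            rw [div_le_iff₀ hN] at hM
            have : ∑ j ∈ s, |f j W - y j| ≤ N * M := by linarith
            gcongr
        _ = _ := by ring
    refine (norm_sub_le _ _).trans ?_
    rw [norm_smul, Real.norm_of_nonneg (by positivity)]
    have h3 : η / N * ‖∑ j ∈ s, (f j (c a) - y j) • (fderiv ℝ (G j) (c a) D)‖ ≤ η * ((κ * (M + b * ‖D‖)) * ‖D‖) := by
      calc _ ≤ η / N * (N * ((κ * (M + b * ‖D‖)) * ‖D‖)) := by gcongr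
        _ = _ := by field_simp
    linarith
  have := norm_image_sub_le_of_norm_deriv_le_segment_01' (f := F) (fun a _ => (hF a).hasDerivWithinAt) hbd
  rw [norm_sub_rev]
  simpa [F, c, hD] using this

end Abstract

/-- pre-activation -/
noncomputable def dotk {d m : ℕ} (x : Input d) (W : Param d m) (k : Fin m) : ℝ := ∑ j : Fin d, W (k, j) * x j

/-- network gradient -/
noncomputable def Gf {d m : ℕ} (φ : ℝ → ℝ) (u : Fin m → ℝ) (x : Input d) (W : Param d m) : Param d m :=
  WithLp.toLp 2 (fun p : Fin m × Fin d => u p.1 * deriv φ (dotk x W p.1) * x p.2)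

lemma dotk_sub {d m : ℕ} (x : Input d) (W V : Param d m) (k : Fin m) :
    dotk x (W - V) k = dotk x W k - dotk x V k := by
  simp [dotk, sub_mul]

lemma norm_toLp_sq {d m : ℕ} (a : Fin m → ℝ) (x : Input d) :
    ‖(WithLp.toLp 2 (fun p : Fin m × Fin d => a p.1 * x p.2) : Param d m)‖^2 = (∑ k, a k ^2) * ‖x‖^2 := by
  rw [EuclideanSpace.norm_sq_eq, EuclideanSpace.norm_sq_eq, Fintype.sum_prod_type, Finset.sum_mul]
  refine Finset.sum_congr rfl fun k _ => ?_
  rw [Finset.mul_sum]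
  refine Finset.sum_congr rfl fun j _ => ?_
  simp [mul_pow]

lemma sum_dotk_sq {d m : ℕ} (x : Input d) (V : Param d m) :
    ∑ k, dotk x V k ^ 2 ≤ ‖x‖^2 * ‖V‖^2 := by
  rw [EuclideanSpace.norm_sq_eq V, Fintype.sum_prod_type, Finset.mul_sum]
  refine Finset.sum_le_sum fun k _ => ?_
  rw [EuclideanSpace.norm_sq_eq, mul_comm]
  simp only [Real.norm_eq_abs, sq_abs]
  exact Finset.sum_mul_sq_le_sq_mul_sq _ _ _

lemma u_sq {m : ℕ} (u : Fin m → ℝ) (hu : ∀ k, u k = 1 / Real.sqrt m ∨ u k = -(1 / Real.sqrt m)) (k : Fin m) :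
    u k ^ 2 = 1 / m := by
  rcases hu k with h | h <;> rw [h] <;> simp

lemma Gf_diff {d m : ℕ} (φ : ℝ → ℝ) (hφ' : Differentiable ℝ (deriv φ)) (u : Fin m → ℝ) (x : Input d) :
    Differentiable ℝ (Gf φ u x : Param d m → Param d m) := by
  rw [differentiable_euclidean]
  intro p
  simp only [Gf, dotk]
  fun_prop

lemma nnet_grad {d m : ℕ} (φ : ℝ → ℝ) (hφ : Differentiable ℝ φ) (u : Fin m → ℝ) (x : Input d) (W : Param d m) :
    HasGradientAt (fun W => nnet φ u W x) (Gf φ u x W) W := by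
  rw [hasGradientAt_iff_hasFDerivAt]
  let A : Fin m → (Param d m →L[ℝ] ℝ) := fun k => ∑ j : Fin d, x j • (EuclideanSpace.proj (k, j) : Param d m →L[ℝ] ℝ)
  have hA : ∀ k V, A k V = ∑ j : Fin d, V (k, j) * x j := by
    intro k V
    simp only [A, _root_.sum_apply, _root_.smul_apply, smul_eq_mul, PiLp.proj_apply]
    exact Finset.sum_congr rfl fun _ _ => mul_comm _ _
  have h1 : HasFDerivAt (fun W : Param d m => nnet φ u W x) (∑ k, u k • (deriv φ (A k W) • A k)) W := by
    unfold nnet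
    simp only [← hA]
    refine HasFDerivAt.fun_sum fun k _ => ?_
    have := ((hφ (A k W)).hasDerivAt.comp_hasFDerivAt W (A k).hasFDerivAt).const_mul (u k)
    exact this
  refine h1.congr_fderiv ?_
  symm
  ext V
  simp only [InnerProductSpace.toDual_apply_apply, _root_.sum_apply, _root_.smul_apply, smul_eq_mul, hA]
  rw [PiLp.inner_apply, Fintype.sum_prod_type]
  refine Finset.sum_congr rfl fun k _ => ?_
  rw [Finset.mul_sum, Finset.mul_sum]
  refine Finset.sum_congr rfl fun j _ => ?_
  simp [Gf, dotk]; ring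

lemma Gf_bound {d m : ℕ} (φ : ℝ → ℝ) (B' : ℝ) (hB : ∀ s, |deriv φ s| ≤ B') (u : Fin m → ℝ)
    (hu : ∀ k, u k = 1 / Real.sqrt m ∨ u k = -(1 / Real.sqrt m)) (x : Input d) (Cx : ℝ) (hx : ‖x‖ ≤ Cx)
    (W : Param d m) : ‖Gf φ u x W‖ ≤ B' * Cx := by
  have hB0 : 0 ≤ B' := (abs_nonneg _).trans (hB 0)
  have hC0 : 0 ≤ Cx := (norm_nonneg _).trans hx
  refine (abs_le_of_sq_le_sq' ?_ (by positivity)).2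
  unfold Gf
  rw [norm_toLp_sq (fun k => u k * deriv φ (dotk x W k)), mul_pow]
  have : ∑ k, (u k * deriv φ (dotk x W k))^2 ≤ B'^2 := by
    calc _ ≤ ∑ k : Fin m, 1 / (m:ℝ) * B'^2 := by
          refine Finset.sum_le_sum fun k _ => ?_
          rw [mul_pow, u_sq u hu]
          refine mul_le_mul_of_nonneg_left ?_ (by positivity)
          exact sq_le_sq' (by linarith [abs_le.1 (hB (dotk x W k))]) (abs_le.1 (hB (dotk x W k))).2
      _ = (m:ℝ) * (1/m) * B'^2 := by simp [mul_assoc]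
      _ ≤ 1 * B'^2 := by gcongr; rw [mul_one_div]; exact div_self_le_one _
      _ = _ := one_mul _
  gcongr

lemma Gf_lip {d m : ℕ} (φ : ℝ → ℝ) (B : ℝ) (hφ' : Differentiable ℝ (deriv φ))
    (hB : ∀ s, |deriv (deriv φ) s| ≤ B) (u : Fin m → ℝ)
    (hu : ∀ k, u k = 1 / Real.sqrt m ∨ u k = -(1 / Real.sqrt m)) (x : Input d) (Cx : ℝ) (hx : ‖x‖ ≤ Cx)
    (W V : Param d m) : ‖Gf φ u x W - Gf φ u x V‖ ≤ (Cx^2 * B / Real.sqrt m) * ‖W - V‖ := by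
  have hB0 : 0 ≤ B := (abs_nonneg _).trans (hB 0)
  have hC0 : 0 ≤ Cx := (norm_nonneg _).trans hx
  refine (abs_le_of_sq_le_sq' ?_ (by positivity)).2
  have e : Gf φ u x W - Gf φ u x V = WithLp.toLp 2 (fun p : Fin m × Fin d =>
      (u p.1 * (deriv φ (dotk x W p.1) - deriv φ (dotk x V p.1))) * x p.2) := by
    ext p; simp [Gf]; ring
  rw [e, norm_toLp_sq (fun k => u k * (deriv φ (dotk x W k) - deriv φ (dotk x V k)))]
  have : ∑ k, (u k * (deriv φ (dotk x W k) - deriv φ (dotk x V k)))^2 ≤ 1/m * B^2 * (Cx^2 * ‖W - V‖^2) := by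
    calc _ ≤ ∑ k : Fin m, 1 / (m:ℝ) * B^2 * (dotk x (W - V) k)^2 := by
          refine Finset.sum_le_sum fun k _ => ?_
          rw [mul_pow, u_sq u hu, mul_assoc, ← mul_pow, dotk_sub]
          gcongr 1
          rw [← sq_abs, ← sq_abs (B * _), abs_mul, abs_of_nonneg hB0]
          gcongr
          have := Convex.norm_image_sub_le_of_norm_deriv_le (f := deriv φ) (C := B) (s := Set.univ)
            (fun z _ => hφ' z) (fun z _ => hB z) convex_univ (Set.mem_univ (dotk x V k)) (Set.mem_univ (dotk x W k))
          simpa using this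
      _ = 1 / (m:ℝ) * B^2 * ∑ k, (dotk x (W - V) k)^2 := by rw [Finset.mul_sum]
      _ ≤ 1 / (m:ℝ) * B^2 * (‖x‖^2 * ‖W - V‖^2) := by gcongr; exact sum_dotk_sq _ _
      _ ≤ _ := by gcongr
  calc _ ≤ 1/m * B^2 * (Cx^2 * ‖W - V‖^2) * Cx^2 := by gcongr
    _ = _ := by
      rw [mul_pow, div_pow, Real.sq_sqrt (Nat.cast_nonneg m)]; ring

lemma nnet_bound {d m : ℕ} (φ : ℝ → ℝ) (B : ℝ) (hB : ∀ s, |φ s| ≤ B) (u : Fin m → ℝ)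
    (hu : ∀ k, u k = 1 / Real.sqrt m ∨ u k = -(1 / Real.sqrt m)) (x : Input d) (W : Param d m) :
    |nnet φ u W x| ≤ Real.sqrt m * B := by
  have hB0 : 0 ≤ B := (abs_nonneg _).trans (hB 0)
  unfold nnet
  calc _ ≤ ∑ k : Fin m, 1 / Real.sqrt m * B := by
        refine (Finset.abs_sum_le_sum_abs _ _).trans (Finset.sum_le_sum fun k _ => ?_)
        rw [abs_mul]
        have : |u k| = 1 / Real.sqrt m := by
          have h : 0 ≤ 1 / Real.sqrt m := by positivity
          rcases hu k with h' | h' <;> rw [h']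
          · exact abs_of_nonneg h
          · rw [abs_neg, abs_of_nonneg h]
        rw [this]
        gcongr
        exact hB _
    _ = (m / Real.sqrt m) * B := by simp [div_eq_mul_inv, mul_assoc]
    _ = _ := by rw [Real.div_sqrt]

lemma nnet_lip {d m : ℕ} (φ : ℝ → ℝ) (hφ : Differentiable ℝ φ) (B' : ℝ) (hB : ∀ s, |deriv φ s| ≤ B') (u : Fin m → ℝ)
    (hu : ∀ k, u k = 1 / Real.sqrt m ∨ u k = -(1 / Real.sqrt m)) (x : Input d) (Cx : ℝ) (hx : ‖x‖ ≤ Cx)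
    (W V : Param d m) : |nnet φ u W x - nnet φ u V x| ≤ B' * Cx * ‖W - V‖ := by
  have := Convex.norm_image_sub_le_of_norm_hasFDerivWithin_le (𝕜 := ℝ) (f := fun W : Param d m => nnet φ u W x) (C := B' * Cx)
    (s := Set.univ) (fun z _ => (nnet_grad φ hφ u x z).hasFDerivAt.hasFDerivWithinAt)
    (fun z _ => by rw [LinearIsometryEquiv.norm_map]; exact Gf_bound φ B' hB u hu x Cx hx z)
    convex_univ (Set.mem_univ V) (Set.mem_univ W)
  exact this

/-- loss gradient -/
noncomputable def gL {d m : ℕ} (φ : ℝ → ℝ) (u : Fin m → ℝ) (z : Input d × ℝ) (W : Param d m) : Param d m :=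
  (nnet φ u W z.1 - z.2) • Gf φ u z.1 W

lemma sqLoss_grad {d m : ℕ} (φ : ℝ → ℝ) (hφ : Differentiable ℝ φ) (u : Fin m → ℝ) (z : Input d × ℝ) (W : Param d m) :
    HasGradientAt (fun W => sqLoss φ u W z) (gL φ u z W) W := by
  rw [hasGradientAt_iff_hasFDerivAt]
  have h := (nnet_grad φ hφ u z.1 W).hasFDerivAt
  have h2 := ((h.sub_const z.2).pow 2).mul_const (1/2 : ℝ)
  have e : (fun W => sqLoss φ u W z) = fun W => (nnet φ u W z.1 - z.2)^2 * (1/2) := by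
    funext W; simp [sqLoss]; ring
  rw [e]
  refine h2.congr_fderiv ?_
  ext V
  simp [gL]
  ring

lemma empRisk_grad {d m n : ℕ} (φ : ℝ → ℝ) (hφ : Differentiable ℝ φ) (u : Fin m → ℝ) (S : Fin n → Input d × ℝ) (W : Param d m) :
    HasGradientAt (empRisk φ u S) ((1 / (n:ℝ)) • ∑ i, gL φ u (S i) W) W := by
  rw [hasGradientAt_iff_hasFDerivAt]
  have h := (HasFDerivAt.fun_sum (u := Finset.univ) fun i _ => (sqLoss_grad φ hφ u (S i) W).hasFDerivAt).mul_const (1/(n:ℝ))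
  have e : empRisk φ u S = fun W => (∑ i, sqLoss φ u W (S i)) * (1 / (n:ℝ)) := by
    funext W; simp [empRisk]; ring
  rw [e]
  refine h.congr_fderiv ?_
  simp [map_sum]

lemma gd_succ {d m n : ℕ} (φ : ℝ → ℝ) (hφ : Differentiable ℝ φ) (u : Fin m → ℝ) (S : Fin n → Input d × ℝ) (η : ℝ) (W0 : Param d m) (s : ℕ) :
    gdIter η (empRisk φ u S) W0 (s+1) = gdIter η (empRisk φ u S) W0 s
      - η • ((1 / (n:ℝ)) • ∑ i, gL φ u (S i) (gdIter η (empRisk φ u S) W0 s)) := by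
  rw [gdIter, (empRisk_grad φ hφ u S _).gradient]

lemma gL_cont {d m : ℕ} (φ : ℝ → ℝ) (hφ : Differentiable ℝ φ) (hφ' : Differentiable ℝ (deriv φ)) (u : Fin m → ℝ) :
    Continuous (fun q : (Input d × ℝ) × Param d m => gL φ u q.1 q.2) := by
  have h1 := hφ.continuous
  have h2 := hφ'.continuous
  unfold gL nnet Gf dotk
  apply Continuous.fun_smul
  · fun_prop
  · apply (PiLp.continuous_toLp 2 _).comp
    fun_prop

lemma step_cont {α E : Type*} [TopologicalSpace α] [NormedAddCommGroup E] [NormedSpace ℝ E] {n : ℕ}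
    (g : α → E → E) (hg : Continuous (fun q : α × E => g q.1 q.2)) (η c : ℝ)
    (w : (Fin n → α) → E) (hw : Continuous w) :
    Continuous (fun S : Fin n → α => w S - η • (c • ∑ i, g (S i) (w S))) := by
  have h : ∀ i, Continuous (fun S : Fin n → α => g (S i) (w S)) := fun i => by
    have h1 : Continuous (fun S : Fin n → α => S i) := continuous_apply i
    exact hg.comp (h1.prodMk hw)
  fun_prop

lemma gd_cont {d m n : ℕ} (φ : ℝ → ℝ) (hφ : Differentiable ℝ φ) (hφ' : Differentiable ℝ (deriv φ)) (u : Fin m → ℝ) (η : ℝ) (W0 : Param d m) (s : ℕ) :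
    Continuous (fun S : Fin n → Input d × ℝ => gdIter η (empRisk φ u S) W0 s) := by
  induction s with
  | zero => simp only [gdIter]; exact continuous_const
  | succ s ih =>
    simp only [gd_succ φ hφ]
    exact step_cont (gL φ u) (gL_cont φ hφ hφ' u) η (1 / (n:ℝ)) _ ih

lemma mp_update {α : Type*} [MeasurableSpace α] {n : ℕ} (μ : Measure α) [IsProbabilityMeasure μ] (i : Fin n) :
    MeasurePreserving (fun p : (Fin n → α) × (Fin n → α) => Function.update p.1 i (p.2 i))
      ((Measure.pi fun _ : Fin n => μ).prod (Measure.pi fun _ : Fin n => μ)) (Measure.pi fun _ : Fin n => μ) := by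
  have hm : Measurable (fun p : (Fin n → α) × (Fin n → α) => Function.update p.1 i (p.2 i)) := by
    rw [measurable_pi_iff]
    intro j
    by_cases h : j = i
    · subst h; simp; fun_prop
    · simp [h]; fun_prop
  refine ⟨hm, ?_⟩
  symm
  apply Measure.pi_eq
  intro s hs
  rw [Measure.map_apply hm (MeasurableSet.univ_pi hs)]
  have : (fun p : (Fin n → α) × (Fin n → α) => Function.update p.1 i (p.2 i)) ⁻¹' (Set.univ.pi s)
      = (Set.univ.pi (Function.update s i Set.univ)) ×ˢ (Set.univ.pi (Function.update (fun _ => Set.univ) i (s i))) := by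
    ext p
    simp only [Set.mem_preimage, Set.mem_pi, Set.mem_univ, true_implies, Set.mem_prod]
    constructor
    · intro h
      refine ⟨fun j => ?_, fun j => ?_⟩
      · by_cases hj : j = i
        · subst hj; simp
        · simpa [hj] using h j
      · by_cases hj : j = i
        · subst hj; simpa using h j
        · simp [hj]
    · rintro ⟨h1, h2⟩ j
      by_cases hj : j = i
      · subst hj; simpa using h2 j
      · simpa [hj] using h1 j
  rw [this, Measure.prod_prod, Measure.pi_pi, Measure.pi_pi]
  rw [← Finset.mul_prod_erase _ _ (Finset.mem_univ i), ← Finset.mul_prod_erase _ (fun j => μ (Function.update (fun _ => Set.univ) i (s i) j)) (Finset.mem_univ i),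
    ← Finset.mul_prod_erase _ (fun j => μ (s j)) (Finset.mem_univ i)]
  have e1 : ∏ j ∈ Finset.univ.erase i, μ (Function.update s i Set.univ j) = ∏ j ∈ Finset.univ.erase i, μ (s j) :=
    Finset.prod_congr rfl fun j hj => by simp [Finset.ne_of_mem_erase hj]
  have e2 : ∏ j ∈ Finset.univ.erase i, μ (Function.update (fun _ => Set.univ) i (s i) j) = 1 :=
    Finset.prod_eq_one fun j hj => by simp [Finset.ne_of_mem_erase hj]
  rw [e1, e2]
  simp [mul_comm]

/-- standing assumptions on the network -/
structure NetHyp {m : ℕ} (φ : ℝ → ℝ) (B B' B'' : ℝ) (u : Fin m → ℝ) (Cx Cy C0 η : ℝ) : Prop where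
  hφ : Differentiable ℝ φ
  hφ' : Differentiable ℝ (deriv φ)
  hB : ∀ s : ℝ, |φ s| ≤ B
  hB' : ∀ s : ℝ, |deriv φ s| ≤ B'
  hB'' : ∀ s : ℝ, |deriv (deriv φ) s| ≤ B''
  hu : ∀ k, u k = 1 / Real.sqrt m ∨ u k = -(1 / Real.sqrt m)
  hCx : 0 < Cx
  hCy : 0 < Cy
  hC0 : 0 < C0
  hη0 : 0 < η
  hη : η * (Cx ^ 2 * (B' ^ 2 + B'' * B + B'' * Cy / Real.sqrt m)) ≤ 1

/-- good data point -/
def GoodPt {d m : ℕ} (φ : ℝ → ℝ) (u : Fin m → ℝ) (Cx Cy C0 : ℝ) (W0 : Param d m) (z : Input d × ℝ) : Prop :=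
  (‖z.1‖ ≤ Cx ∧ |z.2| ≤ Cy) ∧ sqLoss φ u W0 z ≤ C0

section Main
variable {d m n : ℕ} {φ : ℝ → ℝ} {B B' B'' : ℝ} {u : Fin m → ℝ} {Cx Cy C0 η : ℝ} {W0 : Param d m}

lemma NetHyp.nn (H : NetHyp φ B B' B'' u Cx Cy C0 η) : 0 ≤ B ∧ 0 ≤ B' ∧ 0 ≤ B'' :=
  ⟨(abs_nonneg _).trans (H.hB 0), (abs_nonneg _).trans (H.hB' 0), (abs_nonneg _).trans (H.hB'' 0)⟩

lemma NetHyp.res (H : NetHyp φ B B' B'' u Cx Cy C0 η) {z : Input d × ℝ} (hz : GoodPt φ u Cx Cy C0 W0 z)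
    (W : Param d m) : |nnet φ u W z.1 - z.2| ≤ Real.sqrt m * B + Cy :=
  (abs_sub _ _).trans (add_le_add (nnet_bound φ B H.hB u H.hu _ _) hz.1.2)

lemma NetHyp.gL_lip (H : NetHyp φ B B' B'' u Cx Cy C0 η) {z : Input d × ℝ} (hz : GoodPt φ u Cx Cy C0 W0 z)
    (W V : Param d m) : ‖gL φ u z W - gL φ u z V‖
      ≤ (Cx ^ 2 * (B' ^ 2 + B'' * B + B'' * Cy / Real.sqrt m)) * ‖W - V‖ := by
  obtain ⟨n1, n2, n3⟩ := H.nn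
  have hCx := H.hCx
  have hCy := H.hCy
  have e : gL φ u z W - gL φ u z V = (nnet φ u W z.1 - z.2) • (Gf φ u z.1 W - Gf φ u z.1 V)
      + (nnet φ u W z.1 - nnet φ u V z.1) • Gf φ u z.1 V := by
    simp only [gL]; module
  rw [e]
  refine (norm_add_le _ _).trans ?_
  rw [norm_smul, norm_smul, Real.norm_eq_abs, Real.norm_eq_abs]
  have h1 := H.res hz W
  have h2 := Gf_lip φ B'' H.hφ' H.hB'' u H.hu z.1 Cx hz.1.1 W V
  have h3 := nnet_lip φ H.hφ B' H.hB' u H.hu z.1 Cx hz.1.1 W V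
  have h4 := Gf_bound φ B' H.hB' u H.hu z.1 Cx hz.1.1 V
  calc _ ≤ (Real.sqrt m * B + Cy) * ((Cx^2 * B'' / Real.sqrt m) * ‖W - V‖) + (B' * Cx * ‖W - V‖) * (B' * Cx) := by
        gcongr
    _ = (Real.sqrt m / Real.sqrt m * (Cx^2 * B'' * B) + Cx^2 * (B'^2 + B'' * Cy / Real.sqrt m)) * ‖W - V‖ := by ring
    _ ≤ (1 * (Cx^2 * B'' * B) + Cx^2 * (B'^2 + B'' * Cy / Real.sqrt m)) * ‖W - V‖ := by
        gcongr
        exact div_self_le_one _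
    _ = _ := by ring

lemma NetHyp.gL_bound (H : NetHyp φ B B' B'' u Cx Cy C0 η) {z : Input d × ℝ} (hz : GoodPt φ u Cx Cy C0 W0 z)
    (W : Param d m) : ‖gL φ u z W‖ ≤ (Real.sqrt m * B + Cy) * (B' * Cx) := by
  obtain ⟨n1, n2, n3⟩ := H.nn
  have hCy := H.hCy
  rw [gL, norm_smul, Real.norm_eq_abs]
  have h1 := H.res hz W
  have h4 := Gf_bound φ B' H.hB' u H.hu z.1 Cx hz.1.1 W
  gcongr

lemma NetHyp.traj (H : NetHyp φ B B' B'' u Cx Cy C0 η) (hn : 1 ≤ n) {S : Fin n → Input d × ℝ}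
    (hS : ∀ j, GoodPt φ u Cx Cy C0 W0 (S j)) (s t : ℕ) (hst : s ≤ t) :
    ‖gdIter η (empRisk φ u S) W0 s - W0‖ ≤ Real.sqrt 2 * Real.sqrt C0 * Real.sqrt (η * t) ∧
    (∑ j, |nnet φ u (gdIter η (empRisk φ u S) W0 s) (S j).1 - (S j).2|) / n ≤ Real.sqrt 2 * Real.sqrt C0 := by
  have hn' : (0:ℝ) < n := by exact_mod_cast hn
  have hη0 := H.hη0
  set w := gdIter η (empRisk φ u S) W0 with hw
  have hlip : ∀ W V : Param d m, ‖(1 / (n:ℝ)) • ∑ i, gL φ u (S i) W - (1 / (n:ℝ)) • ∑ i, gL φ u (S i) V‖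
      ≤ (Cx ^ 2 * (B' ^ 2 + B'' * B + B'' * Cy / Real.sqrt m)) * ‖W - V‖ := by
    intro W V
    rw [← smul_sub, ← Finset.sum_sub_distrib, norm_smul, Real.norm_of_nonneg (by positivity)]
    calc _ ≤ 1 / (n:ℝ) * ∑ i : Fin n, (Cx ^ 2 * (B' ^ 2 + B'' * B + B'' * Cy / Real.sqrt m)) * ‖W - V‖ := by
          gcongr
          exact (norm_sum_le _ _).trans (Finset.sum_le_sum fun i _ => H.gL_lip (hS i) W V)
      _ = _ := by rw [Finset.sum_const, Finset.card_univ, Fintype.card_fin, nsmul_eq_mul]; field_simp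
  have hpos : ∀ W, 0 ≤ empRisk φ u S W := by
    intro W; unfold empRisk sqLoss; positivity
  have hgd := aux_gd (empRisk φ u S) (fun W => (1 / (n:ℝ)) • ∑ i, gL φ u (S i) W) _ η
    (empRisk_grad φ H.hφ u S) hlip hη0 H.hη w (gd_succ φ H.hφ u S η W0) s
  have h0 : empRisk φ u S (w 0) ≤ C0 := by
    show empRisk φ u S W0 ≤ C0
    unfold empRisk
    rw [div_le_iff₀ hn']
    calc _ ≤ ∑ i : Fin n, C0 := Finset.sum_le_sum fun i _ => (hS i).2
      _ = _ := by simp [mul_comm]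
  have hst' : (s:ℝ) ≤ t := by exact_mod_cast hst
  obtain ⟨g1, g2⟩ := hgd
  constructor
  · rw [← Real.sqrt_mul (by norm_num), ← Real.sqrt_mul (by have := H.hC0; positivity)]
    apply Real.le_sqrt_of_sq_le
    calc _ ≤ _ := g2
      _ ≤ 2 * η * t * (C0 - 0) := by
        gcongr
        exact hpos _
      _ = _ := by ring
  · rw [← Real.sqrt_mul (by norm_num)]
    apply Real.le_sqrt_of_sq_le
    have e1 : (∑ j, |nnet φ u (w s) (S j).1 - (S j).2|)^2 ≤ n * (2 * (n * empRisk φ u S (w s))) := by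
      calc _ ≤ ((Finset.univ : Finset (Fin n)).card : ℝ) * ∑ j, |nnet φ u (w s) (S j).1 - (S j).2|^2 := sq_sum_le_card_mul_sum_sq
        _ = _ := by
          have : (n:ℝ) * empRisk φ u S (w s) = ∑ i, sqLoss φ u (w s) (S i) := by
            unfold empRisk; field_simp
          rw [this]
          simp only [sqLoss, sq_abs, Finset.card_univ, Fintype.card_fin]
          rw [← Finset.sum_div]
          ring
    rw [div_pow, div_le_iff₀ (by positivity)]
    calc _ ≤ _ := e1
      _ ≤ n * (2 * (n * C0)) := by gcongr; linarith
      _ = _ := by ring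

lemma young {E : Type*} [NormedAddCommGroup E] (a b c : E) (t : ℝ) (ht : 0 < t) :
    ‖a - (b - c)‖^2 ≤ (1 + 1/t) * ‖a‖^2 + (1 + t) * (2 * (‖b‖^2 + ‖c‖^2)) := by
  have h1 : ‖a - (b - c)‖ ≤ ‖a‖ + (‖b‖ + ‖c‖) := (norm_sub_le _ _).trans (by gcongr; exact norm_sub_le _ _)
  set x := ‖a‖
  set y := ‖b‖ + ‖c‖ with hy
  have h2 : (x + y)^2 ≤ (1 + 1/t) * x^2 + (1 + t) * y^2 := by
    have : 0 ≤ (x - t * y)^2 / t := by positivity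
    have e : (x - t * y)^2 / t = 1/t * x^2 - 2 * x * y + t * y^2 := by field_simp; ring
    nlinarith
  have h3 : y^2 ≤ 2 * (‖b‖^2 + ‖c‖^2) := by rw [hy]; nlinarith [sq_nonneg (‖b‖ - ‖c‖)]
  calc _ ≤ (x + y)^2 := by gcongr
    _ ≤ _ := h2
    _ ≤ _ := by gcongr

lemma NetHyp.step (H : NetHyp φ B B' B'' u Cx Cy C0 η) (hn : 1 ≤ n) {S S' : Fin n → Input d × ℝ} (i : Fin n)
    (hS : ∀ j, GoodPt φ u Cx Cy C0 W0 (S j)) (hS' : ∀ j, GoodPt φ u Cx Cy C0 W0 (S' j))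
    (hSS : ∀ j, j ≠ i → S' j = S j) (s t : ℕ) (hst : s ≤ t) (ht : 0 < t) (ε : ℝ)
    (hεdef : ε = 2 * Cx ^ 2 * Real.sqrt C0 * B''
        * (4 * B' * Cx * Real.sqrt (η * t) + Real.sqrt 2) / Real.sqrt m)
    (hε : 2 * η * ε < 1) :
    ‖gdIter η (empRisk φ u S) W0 (s+1) - gdIter η (empRisk φ u S') W0 (s+1)‖ ^ 2
      ≤ ((1 + 1 / (t:ℝ)) * (1 / (1 - 2 * η * ε))) * ‖gdIter η (empRisk φ u S) W0 s - gdIter η (empRisk φ u S') W0 s‖^2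
        + (1 + t) * (2 * (η^2 / n^2)) * (‖gL φ u (S i) (gdIter η (empRisk φ u S) W0 s)‖^2
            + ‖gL φ u (S' i) (gdIter η (empRisk φ u S') W0 s)‖^2) := by
  obtain ⟨n1, n2, n3⟩ := H.nn
  have hCx := H.hCx
  have hCy := H.hCy
  have hη0 := H.hη0
  have hn' : (0:ℝ) < n := by exact_mod_cast hn
  have ht' : (0:ℝ) < t := by exact_mod_cast ht
  rw [gd_succ φ H.hφ, gd_succ φ H.hφ]
  obtain ⟨a1, a2⟩ := H.traj hn hS s t hst
  obtain ⟨b1, -⟩ := H.traj hn hS' s t hst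
  set W := gdIter η (empRisk φ u S) W0 s
  set V := gdIter η (empRisk φ u S') W0 s
  set κ := Cx^2 * B'' / Real.sqrt m with hκ
  set b := B' * Cx with hb
  have hκ0 : 0 ≤ κ := by positivity
  have hb0 : 0 ≤ b := by positivity
  have hηb : η * b^2 ≤ 2 := by
    have h := H.hη
    have : η * b^2 ≤ η * (Cx ^ 2 * (B' ^ 2 + B'' * B + B'' * Cy / Real.sqrt m)) := by
      rw [hb]
      have : 0 ≤ η * (Cx^2 * (B'' * B + B'' * Cy / Real.sqrt m)) := by positivity
      linarith
    linarith
  have hc := aux_contract (Finset.univ.erase i) (n:ℝ) hn' (by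
      have : ((Finset.univ : Finset (Fin n)).erase i).card ≤ n := (Finset.card_le_univ _).trans (by simp)
      exact_mod_cast this) b κ η (Real.sqrt 2 * Real.sqrt C0) hb0 hη0 hηb
      (fun j W => nnet φ u W (S j).1) (fun j => (S j).2) (fun j => Gf φ u (S j).1)
      (fun j _ W => nnet_grad φ H.hφ u (S j).1 W) (fun j _ => Gf_diff φ H.hφ' u _)
      (fun j _ W => Gf_bound φ B' H.hB' u H.hu _ Cx (hS j).1.1 W)
      (fun j _ W V => Gf_lip φ B'' H.hφ' H.hB'' u H.hu _ Cx (hS j).1.1 W V) hκ0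
      (fun j _ W V => nnet_lip φ H.hφ B' H.hB' u H.hu _ Cx (hS j).1.1 W V) W V (by
        refine le_trans ?_ a2
        gcongr
        exact Finset.erase_subset _ _)
  set X := (W - (η / n) • ∑ j ∈ Finset.univ.erase i, (nnet φ u W (S j).1 - (S j).2) • Gf φ u (S j).1 W)
    - (V - (η / n) • ∑ j ∈ Finset.univ.erase i, (nnet φ u V (S j).1 - (S j).2) • Gf φ u (S j).1 V) with hX
  have hdec : (W - η • (1 / (n:ℝ)) • ∑ i, gL φ u (S i) W) - (V - η • (1 / (n:ℝ)) • ∑ i, gL φ u (S' i) V)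
      = X - ((η / n) • gL φ u (S i) W - (η / n) • gL φ u (S' i) V) := by
    rw [← Finset.add_sum_erase _ _ (Finset.mem_univ i), ← Finset.add_sum_erase _ (fun j => gL φ u (S' j) V) (Finset.mem_univ i)]
    have : ∑ j ∈ Finset.univ.erase i, gL φ u (S' j) V = ∑ j ∈ Finset.univ.erase i, gL φ u (S j) V :=
      Finset.sum_congr rfl fun j hj => by rw [hSS j (Finset.ne_of_mem_erase hj)]
    rw [this, hX]
    change _ = (W - (η / n) • ∑ j ∈ Finset.univ.erase i, gL φ u (S j) W)
      - (V - (η / n) • ∑ j ∈ Finset.univ.erase i, gL φ u (S j) V) - _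
    rw [smul_smul, smul_smul, mul_one_div, smul_add, smul_add]
    abel
  rw [hdec]
  have hWV : ‖W - V‖ ≤ 2 * (Real.sqrt 2 * Real.sqrt C0 * Real.sqrt (η * t)) := by
    have : W - V = (W - W0) - (V - W0) := by abel
    rw [this]
    exact (norm_sub_le _ _).trans (by linarith)
  have hq : (1 + η * (κ * (Real.sqrt 2 * Real.sqrt C0 + b * ‖W - V‖)))^2 ≤ 1 / (1 - 2 * η * ε) := by
    set x := η * (κ * (Real.sqrt 2 * Real.sqrt C0 + b * ‖W - V‖)) with hx
    have hx0 : 0 ≤ x := by positivity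
    have hxε : x ≤ η * ε := by
      rw [hx]
      gcongr
      calc κ * (Real.sqrt 2 * Real.sqrt C0 + b * ‖W - V‖)
          ≤ κ * (Real.sqrt 2 * Real.sqrt C0 + b * (2 * (Real.sqrt 2 * Real.sqrt C0 * Real.sqrt (η * t)))) := by gcongr
        _ = κ * (Real.sqrt C0 * (Real.sqrt 2 + b * (2 * (Real.sqrt 2 * Real.sqrt (η * t))))) := by ring
        _ ≤ κ * (Real.sqrt C0 * (2 * Real.sqrt 2 + b * (2 * (4 * Real.sqrt (η * t))))) := by
          have : Real.sqrt 2 ≤ 4 := by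
            rw [Real.sqrt_le_left (by norm_num)]; norm_num
          gcongr
          linarith [Real.sqrt_nonneg 2]
        _ = ε := by rw [hεdef, hκ, hb]; ring
    rw [le_div_iff₀ (by linarith)]
    calc (1 + x)^2 * (1 - 2 * η * ε) ≤ (1 + x)^2 * (1 - 2 * x) := mul_le_mul_of_nonneg_left (by linarith) (by positivity)
      _ ≤ 1 := by nlinarith [pow_nonneg hx0 3, sq_nonneg x]
  have hX2 : ‖X‖^2 ≤ 1 / (1 - 2 * η * ε) * ‖W - V‖^2 := by
    calc ‖X‖^2 ≤ ((1 + η * (κ * (Real.sqrt 2 * Real.sqrt C0 + b * ‖W - V‖))) * ‖W - V‖)^2 := by gcongr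
      _ = _ := mul_pow _ _ _
      _ ≤ _ := by gcongr
  refine (young X _ _ t ht').trans ?_
  rw [norm_smul, norm_smul, Real.norm_of_nonneg (by positivity), mul_pow, mul_pow, div_pow]
  calc _ ≤ (1 + 1 / (t:ℝ)) * (1 / (1 - 2 * η * ε) * ‖W - V‖^2) + (1 + t) * (2 * (η^2/n^2 * ‖gL φ u (S i) W‖^2 + η^2/n^2 * ‖gL φ u (S' i) V‖^2)) := by gcongr
    _ = _ := by ring

lemma NetHyp.point (H : NetHyp φ B B' B'' u Cx Cy C0 η) (hn : 1 ≤ n) {S S' : Fin n → Input d × ℝ} (i : Fin n)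
    (hS : ∀ j, GoodPt φ u Cx Cy C0 W0 (S j)) (hS' : ∀ j, GoodPt φ u Cx Cy C0 W0 (S' j))
    (hSS : ∀ j, j ≠ i → S' j = S j) (t : ℕ) (ht : 0 < t) (ε : ℝ)
    (hεdef : ε = 2 * Cx ^ 2 * Real.sqrt C0 * B''
        * (4 * B' * Cx * Real.sqrt (η * t) + Real.sqrt 2) / Real.sqrt m)
    (hε : 2 * η * ε < 1) :
    ‖gdIter η (empRisk φ u S) W0 (t+1) - gdIter η (empRisk φ u S') W0 (t+1)‖ ^ 2
      ≤ (4 * Real.exp 1 * (η ^ 2 * t / (n : ℝ) ^ 2) * (1 / (1 - 2 * η * ε)) ^ t) *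
        ∑ j ∈ Finset.range (t+1), (‖gL φ u (S i) (gdIter η (empRisk φ u S) W0 j)‖^2
            + ‖gL φ u (S' i) (gdIter η (empRisk φ u S') W0 j)‖^2) := by
  obtain ⟨n1, n2, n3⟩ := H.nn
  have hη0 := H.hη0
  have hCx := H.hCx
  have ht' : (1:ℝ) ≤ t := by exact_mod_cast ht
  have ht0 : (0:ℝ) < t := by linarith
  have hε0 : 0 ≤ ε := by rw [hεdef]; positivity
  set q := 1 / (1 - 2 * η * ε) with hq
  have hq1 : 1 ≤ q := by
    rw [hq, le_div_iff₀ (by linarith)]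
    have : 0 ≤ 2 * η * ε := by positivity
    linarith
  set F : ℕ → ℝ := fun j => ‖gL φ u (S i) (gdIter η (empRisk φ u S) W0 j)‖^2
            + ‖gL φ u (S' i) (gdIter η (empRisk φ u S') W0 j)‖^2 with hF
  have hF0 : ∀ j, 0 ≤ F j := fun j => by simp only [hF]; positivity
  set Q := (1 + 1 / (t:ℝ)) * q with hQ
  have hQ1 : 1 ≤ Q := by
    have : 0 ≤ 1 / (t:ℝ) := by positivity
    rw [hQ]; nlinarith
  set C := (1 + t) * (2 * (η^2 / n^2)) with hC
  have hC0' : 0 ≤ C := by positivity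
  have key : ∀ s, s ≤ t → ‖gdIter η (empRisk φ u S) W0 (s+1) - gdIter η (empRisk φ u S') W0 (s+1)‖ ^ 2
      ≤ Q^s * C * ∑ j ∈ Finset.range (s+1), F j := by
    intro s
    induction s with
    | zero =>
      intro h
      have := H.step hn i hS hS' hSS 0 t h ht ε hεdef hε
      simpa [gdIter, hF, hC] using this
    | succ s ih =>
      intro h
      have h1 := H.step hn i hS hS' hSS (s+1) t h ht ε hεdef hε
      have h2 := ih (by omega)
      rw [Finset.sum_range_succ]
      refine h1.trans ?_
      have hQs : 1 ≤ Q^(s+1) := one_le_pow₀ hQ1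
      have h3 : Q * ‖gdIter η (empRisk φ u S) W0 (s+1) - gdIter η (empRisk φ u S') W0 (s+1)‖ ^ 2
        ≤ Q * (Q^s * C * ∑ j ∈ Finset.range (s+1), F j) := by gcongr
      have h4 : 1 * (C * F (s+1)) ≤ Q^(s+1) * (C * F (s+1)) := by
        have := hF0 (s+1)
        gcongr
      calc _ ≤ Q * (Q^s * C * ∑ j ∈ Finset.range (s+1), F j) + 1 * (C * F (s+1)) := by
            rw [one_mul]; exact add_le_add h3 le_rfl
        _ ≤ Q * (Q^s * C * ∑ j ∈ Finset.range (s+1), F j) + Q^(s+1) * (C * F (s+1)) := by gcongr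
        _ = _ := by ring
  refine (key t le_rfl).trans ?_
  have hs : 0 ≤ ∑ j ∈ Finset.range (t+1), F j := Finset.sum_nonneg fun j _ => hF0 j
  refine mul_le_mul_of_nonneg_right ?_ hs
  have he : (1 + 1 / (t:ℝ))^t ≤ Real.exp 1 := by
    calc (1 + 1 / (t:ℝ))^t ≤ (Real.exp (1 / (t:ℝ)))^t := by
          gcongr
          rw [add_comm]; exact Real.add_one_le_exp _
      _ = _ := by rw [← Real.exp_nat_mul]; congr 1; field_simp
  rw [hQ, mul_pow, hC]
  calc (1 + 1 / (t:ℝ))^t * q^t * ((1 + t) * (2 * (η^2 / n^2)))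
      ≤ Real.exp 1 * q^t * ((t + t) * (2 * (η^2 / n^2))) := by gcongr
    _ = _ := by ring

end Main


/-- bound on on-average parameter stability (Lemma 5 of the paper). -/
theorem statement5 {d m n : ℕ} (hn : 1 ≤ n)
    (φ : ℝ → ℝ) (Bφ Bφ' Bφ'' : ℝ)
    (hφ : Differentiable ℝ φ) (hφ' : Differentiable ℝ (deriv φ))
    (hBφ : ∀ s : ℝ, |φ s| ≤ Bφ) (hBφ' : ∀ s : ℝ, |deriv φ s| ≤ Bφ')
    (hBφ'' : ∀ s : ℝ, |deriv (deriv φ) s| ≤ Bφ'')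
    (u : Fin m → ℝ) (hu : ∀ k, u k = 1 / Real.sqrt m ∨ u k = -(1 / Real.sqrt m))
    (Cx Cy C0 : ℝ) (hCx : 0 < Cx) (hCy : 0 < Cy) (hC0 : 0 < C0)
    (μ : Measure (Input d × ℝ)) [IsProbabilityMeasure μ]
    (hsupp : ∀ᵐ z ∂μ, ‖z.1‖ ≤ Cx ∧ |z.2| ≤ Cy)
    (W0 : Param d m) (hloss0 : ∀ᵐ z ∂μ, sqLoss φ u W0 z ≤ C0)
    (η : ℝ) (hη0 : 0 < η)
    (ρ : ℝ) (hρ : ρ = Cx ^ 2 * (Bφ' ^ 2 + Bφ'' * Bφ + Bφ'' * Cy / Real.sqrt m))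
    (hη : η ≤ 1 / (2 * ρ))
    (t : ℕ) (ht : 0 < t)
    (ε : ℝ) (hεdef : ε = 2 * Cx ^ 2 * Real.sqrt C0 * Bφ''
        * (4 * Bφ' * Cx * Real.sqrt (η * t) + Real.sqrt 2) / Real.sqrt m)
    (hε : 2 * η * ε < 1) :
    (1 / (n : ℝ)) * ∑ i : Fin n,
        ∫ p : (Fin n → Input d × ℝ) × (Fin n → Input d × ℝ),
          ‖gdIter η (empRisk φ u p.1) W0 (t + 1)
            - gdIter η (empRisk φ u (Function.update p.1 i (p.2 i))) W0 (t + 1)‖ ^ 2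
          ∂((Measure.pi fun _ : Fin n => μ).prod (Measure.pi fun _ : Fin n => μ))
      ≤ 8 * Real.exp 1 * (η ^ 2 * t / (n : ℝ) ^ 2) * (1 / (1 - 2 * η * ε)) ^ t
          * ((1 / (n : ℝ)) * ∑ i : Fin n, ∑ j ∈ Finset.range (t + 1),
              ∫ p : (Fin n → Input d × ℝ) × (Fin n → Input d × ℝ),
                ‖gradient (fun W => sqLoss φ u W (p.1 i))
                    (gdIter η (empRisk φ u p.1) W0 j)‖ ^ 2
                ∂((Measure.pi fun _ : Fin n => μ).prod (Measure.pi fun _ : Fin n => μ))) := by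
  have nB : 0 ≤ Bφ := (abs_nonneg _).trans (hBφ 0)
  have nB'' : 0 ≤ Bφ'' := (abs_nonneg _).trans (hBφ'' 0)
  have hρ0 : 0 ≤ ρ := by rw [hρ]; positivity
  have hηρ : η * ρ ≤ 1 := by
    rcases hρ0.eq_or_lt with h | h
    · rw [← h]; norm_num
    · rw [le_div_iff₀ (by positivity)] at hη
      linarith
  have H : NetHyp φ Bφ Bφ' Bφ'' u Cx Cy C0 η :=
    ⟨hφ, hφ', hBφ, hBφ', hBφ'', hu, hCx, hCy, hC0, hη0, hρ ▸ hηρ⟩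
  have hn' : (0:ℝ) < n := by exact_mod_cast hn
  have hgrad : ∀ (z : Input d × ℝ) (W : Param d m), gradient (fun W => sqLoss φ u W z) W = gL φ u z W :=
    fun z W => (sqLoss_grad φ hφ u z W).gradient
  simp only [hgrad]
  set ν := Measure.pi fun _ : Fin n => μ with hν
  set K := 4 * Real.exp 1 * (η ^ 2 * t / (n : ℝ) ^ 2) * (1 / (1 - 2 * η * ε)) ^ t with hK
  have hK0 : 0 ≤ K := by
    have : 0 ≤ 1 - 2 * η * ε := by linarith
    positivity
  clear_value K
  have hgood : ∀ᵐ S ∂ν, ∀ j, GoodPt φ u Cx Cy C0 W0 (S j) := by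
    rw [ae_all_iff]
    intro j
    have hz : ∀ᵐ z ∂μ, GoodPt φ u Cx Cy C0 W0 z := by
      filter_upwards [hsupp, hloss0] with z h1 h2 using ⟨h1, h2⟩
    exact (measurePreserving_eval (fun _ : Fin n => μ) j).quasiMeasurePreserving.ae hz
  let F : Fin n → ℕ → (Fin n → Input d × ℝ) → ℝ := fun i j S =>
    ‖gL φ u (S i) (gdIter η (empRisk φ u S) W0 j)‖ ^ 2
  have hFint : ∀ i j, Integrable (F i j) ν := by
    intro i j
    have hc : Continuous (F i j) := by
      have h := (gL_cont φ hφ hφ' u).comp ((continuous_apply i).prodMk (gd_cont (n := n) φ hφ hφ' u η W0 j))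
      exact h.norm.pow 2
    refine Integrable.of_bound hc.aestronglyMeasurable (((Real.sqrt m * Bφ + Cy) * (Bφ' * Cx))^2) ?_
    filter_upwards [hgood] with S hS
    have := H.gL_bound (hS i) (gdIter η (empRisk φ u S) W0 j)
    rw [Real.norm_of_nonneg (by positivity)]
    simp only [F]
    gcongr
  have mp1 : MeasurePreserving (Prod.fst : (Fin n → Input d × ℝ) × (Fin n → Input d × ℝ) → _) (ν.prod ν) ν :=
    measurePreserving_fst
  have mp2 : ∀ i, MeasurePreserving (fun p : (Fin n → Input d × ℝ) × (Fin n → Input d × ℝ) => Function.update p.1 i (p.2 i)) (ν.prod ν) ν :=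
    fun i => mp_update μ i
  have i1 : ∀ i j, Integrable (fun p : (Fin n → Input d × ℝ) × (Fin n → Input d × ℝ) => F i j p.1) (ν.prod ν) :=
    fun i j => mp1.integrable_comp_of_integrable (hFint i j)
  have i2 : ∀ i j, Integrable (fun p : (Fin n → Input d × ℝ) × (Fin n → Input d × ℝ) =>
      F i j (Function.update p.1 i (p.2 i))) (ν.prod ν) :=
    fun i j => (mp2 i).integrable_comp_of_integrable (hFint i j)
  have e1 : ∀ i j, ∫ p : (Fin n → Input d × ℝ) × (Fin n → Input d × ℝ), F i j p.1 ∂(ν.prod ν) = ∫ S, F i j S ∂ν := by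
    intro i j
    have := integral_map (μ := ν.prod ν) (φ := Prod.fst) mp1.measurable.aemeasurable (f := F i j)
      (by rw [mp1.map_eq]; exact (hFint i j).aestronglyMeasurable)
    rw [← this, mp1.map_eq]
  have e2 : ∀ i j, ∫ p : (Fin n → Input d × ℝ) × (Fin n → Input d × ℝ),
      F i j (Function.update p.1 i (p.2 i)) ∂(ν.prod ν) = ∫ S, F i j S ∂ν := by
    intro i j
    have := integral_map (μ := ν.prod ν) (mp2 i).measurable.aemeasurable (f := F i j)
      (by rw [(mp2 i).map_eq]; exact (hFint i j).aestronglyMeasurable)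
    rw [← this, (mp2 i).map_eq]
  have main : ∀ i : Fin n, ∫ p : (Fin n → Input d × ℝ) × (Fin n → Input d × ℝ),
          ‖gdIter η (empRisk φ u p.1) W0 (t + 1)
            - gdIter η (empRisk φ u (Function.update p.1 i (p.2 i))) W0 (t + 1)‖ ^ 2 ∂(ν.prod ν)
      ≤ 2 * K * ∑ j ∈ Finset.range (t+1), ∫ p : (Fin n → Input d × ℝ) × (Fin n → Input d × ℝ), F i j p.1 ∂(ν.prod ν) := by
    intro i
    calc _ ≤ ∫ p : (Fin n → Input d × ℝ) × (Fin n → Input d × ℝ),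
          K * ∑ j ∈ Finset.range (t+1), (F i j p.1 + F i j (Function.update p.1 i (p.2 i))) ∂(ν.prod ν) := by
          apply integral_mono_of_nonneg
          · exact Filter.Eventually.of_forall fun p => by positivity
          · exact (integrable_finsetSum _ fun j _ => (i1 i j).add (i2 i j)).const_mul _
          · have g1 := mp1.quasiMeasurePreserving.ae hgood
            have g2 := (mp2 i).quasiMeasurePreserving.ae hgood
            filter_upwards [g1, g2] with p h1 h2
            have := H.point hn i h1 h2 (fun j hj => by simp [hj]) t ht ε hεdef hε
            rw [← hK] at this
            exact this
      _ = _ := by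
          rw [integral_const_mul, integral_finsetSum _ fun j _ => (i1 i j).fun_add (i2 i j)]
          have h2 : ∀ j ∈ Finset.range (t+1), ∫ p : (Fin n → Input d × ℝ) × (Fin n → Input d × ℝ), (F i j p.1 + F i j (Function.update p.1 i (p.2 i))) ∂(ν.prod ν)
              = 2 * ∫ p : (Fin n → Input d × ℝ) × (Fin n → Input d × ℝ), F i j p.1 ∂(ν.prod ν) := fun j _ => by
            rw [integral_add (i1 i j) (i2 i j), e1, e2]; ring
          rw [Finset.sum_congr rfl h2, ← Finset.mul_sum, mul_left_comm, mul_assoc]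
  calc _ ≤ (1 / (n:ℝ)) * ∑ i : Fin n, 2 * K * ∑ j ∈ Finset.range (t+1), ∫ p : (Fin n → Input d × ℝ) × (Fin n → Input d × ℝ), F i j p.1 ∂(ν.prod ν) := by
        gcongr with i
        exact main i
    _ = _ := by
        rw [← Finset.mul_sum, hK]; ring
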